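/- If κ(v) < t, then add(v⁰) = cov(v⁰). -/

import Mathlib

open Set

/-- `A`, `B` form a segment when `A ⊆ B` and `B \ A` is infinite. -/
def IsSeg (A B : Set ℕ) : Prop := A ⊆ B ∧ (B \ A).Infinite

/-- The segment `⟨A,B⟩ = {X ∈ [ω]^ω : A ⊆ X ⊆ B}`. -/
def Seg (A B : Set ℕ) : Set (Set ℕ) := {X | X.Infinite ∧ A ⊆ X ∧ X ⊆ B}

/-- `X ⊆* Y` : the set `X \ Y` is finite. -/
def AlmostSub (X Y : Set ℕ) : Prop := (X \ Y).Finite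

/-- The *-segment `⟨A,B⟩* = {X ∈ [ω]^ω : A ⊆* X ⊆* B}`. -/
def StarSeg (A B : Set ℕ) : Set (Set ℕ) := {X | X.Infinite ∧ AlmostSub A X ∧ AlmostSub X B}

/-- `S` is a v⁰-set: every segment contains a segment disjoint from `S`. -/
def IsVZero (S : Set (Set ℕ)) : Prop :=
  ∀ A B, IsSeg A B → ∃ C D, IsSeg C D ∧ Seg C D ⊆ Seg A B ∧ Seg C D ∩ S = ∅

/-- `S` is a v-set: every segment contains a segment inside `S` or disjoint from `S`. -/
def IsVSet (S : Set (Set ℕ)) : Prop :=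
  ∀ A B, IsSeg A B → ∃ C D, IsSeg C D ∧ Seg C D ⊆ Seg A B ∧
    (Seg C D ⊆ S ∨ Seg C D ∩ S = ∅)

/-- A set of infinite subsets of `ℕ` is a *-segment if it is of the form `⟨A,B⟩*`. -/
def IsStarSeg (P : Set (Set ℕ)) : Prop := ∃ A B, IsSeg A B ∧ P = StarSeg A B

/-- Two *-segments are *-disjoint when their intersection is countable. -/
def StarDisjoint (P Q : Set (Set ℕ)) : Prop := (P ∩ Q).Countable

/-- A v-partition: a maximal family of pairwise *-disjoint *-segments. -/
def IsVPartition (P : Set (Set (Set ℕ))) : Prop :=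
  (∀ X ∈ P, IsStarSeg X) ∧
  (∀ X ∈ P, ∀ Y ∈ P, X ≠ Y → StarDisjoint X Y) ∧
  (∀ R, IsStarSeg R → R ∉ P → ∃ X ∈ P, ¬ StarDisjoint R X)

/-- `P` refines `Q`: every member of `P` is contained in some member of `Q`. -/
def Refines (P Q : Set (Set (Set ℕ))) : Prop := ∀ X ∈ P, ∃ Y ∈ Q, X ⊆ Y

/-- A v-matrix is a collection of v-partitions. -/
def IsVMatrix (H : Set (Set (Set (Set ℕ)))) : Prop := ∀ P ∈ H, IsVPartition P

/-- A v-matrix `H` is shattering: for every *-segment `⟨A,B⟩*` some partition in `H`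
has two distinct members whose intersections with `⟨A,B⟩*` are two different *-segments. -/
def Shattering (H : Set (Set (Set (Set ℕ)))) : Prop :=
  IsVMatrix H ∧ ∀ A B, IsSeg A B → ∃ P ∈ H, ∃ X ∈ P, ∃ Y ∈ P, X ≠ Y ∧
    IsStarSeg (X ∩ StarSeg A B) ∧ IsStarSeg (Y ∩ StarSeg A B) ∧
    X ∩ StarSeg A B ≠ Y ∩ StarSeg A B

/-- `κ(v)`: the least cardinality of a shattering v-matrix. -/
noncomputable def kappaV : Cardinal :=
  sInf {c : Cardinal | ∃ H : Set (Set (Set (Set ℕ))), Shattering H ∧ Cardinal.mk ↥H = c}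

/-- `add(v⁰)`: the additivity number of the ideal of v⁰-sets. -/
noncomputable def addV0 : Cardinal :=
  sInf {c : Cardinal | ∃ F : Set (Set (Set ℕ)),
    (∀ S ∈ F, IsVZero S) ∧ ¬ IsVZero (⋃₀ F) ∧ Cardinal.mk ↥F = c}

/-- `cov(v⁰)`: the covering number of the ideal of v⁰-sets. -/
noncomputable def covV0 : Cardinal :=
  sInf {c : Cardinal | ∃ F : Set (Set (Set ℕ)),
    (∀ S ∈ F, IsVZero S) ∧ ⋃₀ F = {X : Set ℕ | X.Infinite} ∧ Cardinal.mk ↥F = c}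

/-- strict almost inclusion `A ⊊* B`. -/
def StrictAlmostSub (A B : Set ℕ) : Prop := AlmostSub A B ∧ ¬ AlmostSub B A

/-- The tower number `t`: the least cardinality of a family of infinite subsets of `ℕ`
well-ordered decreasingly by `⊆*` with no infinite pseudo-intersection. -/
noncomputable def tNum : Cardinal :=
  sInf {c : Cardinal | ∃ T : Set (Set ℕ), (∀ A ∈ T, A.Infinite) ∧
    IsWellOrder ↥T (fun A B => StrictAlmostSub (B : Set ℕ) (A : Set ℕ)) ∧
    (¬ ∃ X : Set ℕ, X.Infinite ∧ ∀ A ∈ T, AlmostSub X A) ∧ Cardinal.mk ↥T = c}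


/-- The *-segment `⟨p.1, p.2⟩*` coded by the pair `p`. -/
def pairSeg (p : Set ℕ × Set ℕ) : Set (Set ℕ) := StarSeg p.1 p.2

/-- The pair `p` codes a nontrivial *-segment. -/
def IsPair (p : Set ℕ × Set ℕ) : Prop := AlmostSub p.1 p.2 ∧ (p.2 \ p.1).Infinite

/-- The order on codes corresponding to inclusion of *-segments. -/
def PairLE (p q : Set ℕ × Set ℕ) : Prop := AlmostSub q.1 p.1 ∧ AlmostSub p.2 q.2

/-- The code of the intersection of two *-segments. -/
def pairMeet (p q : Set ℕ × Set ℕ) : Set ℕ × Set ℕ := (p.1 ∪ q.1, p.2 ∩ q.2)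

/-- A set of codes is dense if it has elements below every code of a *-segment. -/
def PairDense (𝒟 : Set (Set ℕ × Set ℕ)) : Prop := ∀ q, IsPair q → ∃ p ∈ 𝒟, IsPair p ∧ PairLE p q

/-- `R` is a predense subset of `𝒟` whose members code pairwise disjoint *-segments. -/
def IsAntichainIn (𝒟 R : Set (Set ℕ × Set ℕ)) : Prop :=
  R ⊆ 𝒟 ∧ (∀ p ∈ R, IsPair p) ∧ (∀ p ∈ R, ∀ q ∈ R, p ≠ q → Disjoint (pairSeg p) (pairSeg q)) ∧
    ∀ q, IsPair q → ∃ p ∈ R, IsPair (pairMeet p q)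

theorem AlmostSub.trans {A B C : Set ℕ} (h₁ : AlmostSub A B) (h₂ : AlmostSub B C) :
    AlmostSub A C :=
  (h₁.union h₂).subset fun x => by simp only [mem_union, mem_sdiff]; tauto

theorem AlmostSub.of_subset {A B : Set ℕ} (h : A ⊆ B) : AlmostSub A B := by
  simp [AlmostSub, sdiff_eq_empty.2 h]

theorem AlmostSub.infinite {A B : Set ℕ} (h : AlmostSub A B) (hA : A.Infinite) : B.Infinite :=
  fun hB => hA ((h.union hB).subset fun x => by simp only [mem_union, mem_sdiff]; tauto)

theorem PairLE.trans {p q r : Set ℕ × Set ℕ} (h₁ : PairLE p q) (h₂ : PairLE q r) : PairLE p r :=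
  ⟨h₂.1.trans h₁.1, h₁.2.trans h₂.2⟩

theorem PairLE.refl (p : Set ℕ × Set ℕ) : PairLE p p :=
  ⟨.of_subset subset_rfl, .of_subset subset_rfl⟩

theorem pairMeet_le_left (p q : Set ℕ × Set ℕ) : PairLE (pairMeet p q) p :=
  ⟨.of_subset subset_union_left, .of_subset inter_subset_left⟩

theorem pairMeet_le_right (p q : Set ℕ × Set ℕ) : PairLE (pairMeet p q) q :=
  ⟨.of_subset subset_union_right, .of_subset inter_subset_right⟩

theorem PairLE.pairMeet {p q r : Set ℕ × Set ℕ} (h₁ : PairLE r p) (h₂ : PairLE r q) :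
    PairLE r (pairMeet p q) :=
  ⟨(h₁.1.union h₂.1).subset fun x => by simp only [_root_.pairMeet, mem_union, mem_sdiff]; tauto,
    (h₁.2.union h₂.2).subset fun x => by
      simp only [_root_.pairMeet, mem_union, mem_inter_iff, mem_sdiff]; tauto⟩

theorem IsPair.mono {p q : Set ℕ × Set ℕ} (hp : IsPair p) (h : PairLE p q) : IsPair q :=
  ⟨h.1.trans (hp.1.trans h.2), fun hq => hp.2 (((hq.union h.1).union h.2).subset fun x => by
    simp only [mem_union, mem_sdiff]; tauto)⟩

theorem pairSeg_mono {p q : Set ℕ × Set ℕ} (h : PairLE p q) : pairSeg p ⊆ pairSeg q :=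
  fun _ hX => ⟨hX.1, h.1.trans hX.2.1, hX.2.2.trans h.2⟩

theorem pairSeg_inter (p q : Set ℕ × Set ℕ) : pairSeg p ∩ pairSeg q = pairSeg (pairMeet p q) := by
  refine Subset.antisymm (fun X ⟨h₁, h₂⟩ => ⟨h₁.1, ?_, ?_⟩) (subset_inter
    (pairSeg_mono (pairMeet_le_left p q)) (pairSeg_mono (pairMeet_le_right p q)))
  · exact (h₁.2.1.union h₂.2.1).subset fun x => by
      simp only [pairMeet, mem_union, mem_sdiff]; tauto
  · exact (h₁.2.2.union h₂.2.2).subset fun x => by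
      simp only [pairMeet, mem_union, mem_inter_iff, mem_sdiff]; tauto

theorem IsSeg.isPair {A B : Set ℕ} (h : IsSeg A B) : IsPair (A, B) := ⟨.of_subset h.1, h.2⟩

theorem IsPair.isStarSeg {p : Set ℕ × Set ℕ} (h : IsPair p) : IsStarSeg (pairSeg p) := by
  refine ⟨p.1 ∩ p.2, p.2, ⟨inter_subset_right, by simpa using h.2⟩, ?_⟩
  refine Subset.antisymm (fun X hX => ⟨hX.1, ?_, hX.2.2⟩) (fun X hX => ⟨hX.1, ?_, hX.2.2⟩)
  · exact AlmostSub.trans (.of_subset inter_subset_left) hX.2.1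
  · exact (h.1.union hX.2.1).subset fun x => by
      simp only [mem_union, mem_inter_iff, mem_sdiff]; tauto

theorem IsStarSeg.exists_pair {P : Set (Set ℕ)} (h : IsStarSeg P) : ∃ p, IsPair p ∧ P = pairSeg p := by
  obtain ⟨A, B, h, rfl⟩ := h
  exact ⟨(A, B), h.isPair, rfl⟩

theorem IsPair.not_countable {p : Set ℕ × Set ℕ} (h : IsPair p) : ¬ (pairSeg p).Countable := by
  intro hc
  let φ := h.2.natEmbedding
  have hφ : Function.Injective fun Y : Set ℕ => p.1 ∪ (fun n => (φ n : ℕ)) '' Y := by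
    intro Y Z hYZ
    have key : ∀ Y : Set ℕ, ∀ n, n ∈ Y ↔ (φ n : ℕ) ∈ p.1 ∪ (fun n => (φ n : ℕ)) '' Y := by
      intro Y n
      have h1 : (φ n : ℕ) ∉ p.1 := (φ n).2.2
      simp [h1, Subtype.val_inj]
    ext n
    rw [key Y, key Z]
    exact iff_of_eq (congrArg (fun W : Set ℕ => (φ n : ℕ) ∈ W) hYZ)
  have hfin : {X : Set ℕ | X.Finite}.Countable := by
    simpa using Set.countable_ofPred_finite_subset (countable_univ (α := ℕ))
  have := (hc.union hfin).preimage_of_injOn (f := fun Y : Set ℕ => p.1 ∪ (fun n => (φ n : ℕ)) '' Y)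
    hφ.injOn
  have huniv : (fun Y : Set ℕ => p.1 ∪ (fun n => (φ n : ℕ)) '' Y) ⁻¹'
      (pairSeg p ∪ {X : Set ℕ | X.Finite}) = univ := by
    refine eq_univ_of_forall fun Y => ?_
    by_cases hY : (p.1 ∪ (fun n => (φ n : ℕ)) '' Y).Finite
    · exact Or.inr hY
    · refine Or.inl ⟨hY, .of_subset subset_union_left, h.1.subset ?_⟩
      rintro x ⟨hx | ⟨n, -, rfl⟩, hx2⟩
      · exact ⟨hx, hx2⟩
      · exact absurd (φ n).2.1 hx2
  rw [huniv, countable_univ_iff] at this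
  have hle := Cardinal.mk_le_aleph0_iff.2 this
  rw [Cardinal.mk_set, Cardinal.mk_nat] at hle
  exact (Cardinal.cantor Cardinal.aleph0).not_ge hle

theorem diff_finite_of_mem_pairSeg {p : Set ℕ × Set ℕ} (h : ¬ IsPair p) {X Y : Set ℕ}
    (hX : X ∈ pairSeg p) (hY : Y ∈ pairSeg p) : (X \ Y).Finite := by
  have h1 : (p.2 \ p.1).Finite := by
    by_contra h2
    exact h ⟨hX.2.1.trans hX.2.2, h2⟩
  exact ((hX.2.2.union h1).union hY.2.1).subset fun x => by
    simp only [mem_union, mem_sdiff]; tauto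

theorem pairSeg_countable {p : Set ℕ × Set ℕ} (h : ¬ IsPair p) : (pairSeg p).Countable := by
  rcases (pairSeg p).eq_empty_or_nonempty with he | ⟨Y, hY⟩
  · simp [he]
  have hfin : {X : Set ℕ | X.Finite}.Countable := by
    simpa using Set.countable_ofPred_finite_subset (countable_univ (α := ℕ))
  refine (hfin.preimage_of_injOn (f := fun X => symmDiff X Y)
    (symmDiff_left_injective Y).injOn).mono fun X hX => ?_
  exact (diff_finite_of_mem_pairSeg h hX hY).union (diff_finite_of_mem_pairSeg h hY hX)

theorem starDisjoint_pairSeg {p q : Set ℕ × Set ℕ} :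
    StarDisjoint (pairSeg p) (pairSeg q) ↔ ¬ IsPair (pairMeet p q) := by
  rw [StarDisjoint, pairSeg_inter]
  exact ⟨fun h h' => h'.not_countable h, pairSeg_countable⟩

theorem IsPair.nonempty {p : Set ℕ × Set ℕ} (h : IsPair p) : (pairSeg p).Nonempty := by
  by_contra h'
  rw [not_nonempty_iff_eq_empty] at h'
  exact h.not_countable (by simp [h'])

theorem IsStarSeg.not_countable {P : Set (Set ℕ)} (h : IsStarSeg P) : ¬ P.Countable := by
  obtain ⟨p, hp, rfl⟩ := h.exists_pair
  exact hp.not_countable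

theorem exists_infinite_split {E : Set ℕ} (h : E.Infinite) :
    ∃ x ⊆ E, x.Infinite ∧ (E \ x).Infinite := by
  obtain ⟨s, t, hst, hd, hc⟩ := h.exists_union_disjoint_cardinal_eq_of_infinite
  have hE : E \ s = t := by rw [← hst, union_sdiff_left]; exact hd.symm.sdiff_eq_left
  have hfin : s.Finite ↔ t.Finite := by
    rw [← Cardinal.lt_aleph0_iff_set_finite, hc, Cardinal.lt_aleph0_iff_set_finite]
  have hs : s.Infinite := fun hs => h (hst ▸ hs.union (hfin.1 hs))
  exact ⟨s, hst ▸ subset_union_left, hs, hE ▸ fun ht => hs (hfin.2 ht)⟩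

/-- A *-segment below a segment contains a segment that is contained in that segment. -/
theorem IsPair.exists_seg {A B : Set ℕ} {p : Set ℕ × Set ℕ} (hAB : IsSeg A B) (hp : IsPair p)
    (h : PairLE p (A, B)) : ∃ C D, IsSeg C D ∧ Seg C D ⊆ Seg A B ∧ Seg C D ⊆ pairSeg p := by
  have h1 := h.1
  have h2 := h.2
  have h3 := hp.1
  have hsub := hAB.1
  simp only [AlmostSub] at h1 h2 h3
  refine ⟨A ∪ (p.1 ∩ B), A ∪ (p.1 ∩ B) ∪ (p.2 ∩ B), ⟨subset_union_left, ?_⟩, ?_, ?_⟩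
  · refine fun hf => hp.2 (((hf.union h1).union h2).subset fun x => ?_)
    simp only [mem_union, mem_inter_iff, mem_sdiff]; tauto
  · refine fun X hX => ⟨hX.1, subset_union_left.trans hX.2.1, hX.2.2.trans ?_⟩
    exact union_subset (union_subset hsub inter_subset_right) inter_subset_right
  · refine fun X hX => ⟨hX.1, (h2.union h3).subset fun x hx => ?_,
      ((h1.union h3)).subset fun x hx => ?_⟩
    · have := @hX.2.1 x
      simp only [mem_union, mem_inter_iff, mem_sdiff] at *; tauto
    · have := @hX.2.2 x
      simp only [mem_union, mem_inter_iff, mem_sdiff] at *; tauto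

theorem exists_wellFounded_rec {I : Type} [LinearOrder I] [WellFoundedLT I] {β : Type}
    (Q : (i : I) → (∀ j, j < i → β) → β → Prop) (h : ∀ i g, ∃ b, Q i g b) :
    ∃ f : I → β, ∀ i, Q i (fun j _ => f j) (f i) := by
  choose F hF using h
  refine ⟨(wellFounded_lt (α := I)).fix F, fun i => ?_⟩
  rw [WellFounded.fix_eq]
  exact hF i _

/-- Below a *-segment there is one disjoint from fewer than continuum many *-segments that are
incompatible with it. -/
theorem exists_pairLE_disjoint {q : Set ℕ × Set ℕ} (hq : IsPair q) {J : Type}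
    (f : J → Option (Set ℕ × Set ℕ)) (hf : ∀ j s, f j = some s → ¬ IsPair (pairMeet s q))
    (hJ : Cardinal.mk J < Cardinal.mk (Set ℕ)) :
    ∃ q', IsPair q' ∧ PairLE q' q ∧ ∀ j s, f j = some s → Disjoint (pairSeg q') (pairSeg s) := by
  let φ : ℕ → ℕ := fun n => hq.2.natEmbedding _ n
  have hφ : Function.Injective φ := Subtype.val_injective.comp (hq.2.natEmbedding _).injective
  have hφq : ∀ n, φ n ∈ q.2 \ q.1 := fun n => (hq.2.natEmbedding _ n).2
  have hcol : ∀ a, (range fun b => φ (Nat.pair a b)).Infinite := fun a =>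
    infinite_range_of_injective fun b c h => (Nat.pair_eq_pair.1 (hφ h)).2
  let lo : Set ℕ → Set ℕ := fun s => q.1 ∪ {n | ∃ a ∈ s, ∃ b, φ (Nat.pair (a + 1) b) = n}
  let c : Set ℕ → Set ℕ × Set ℕ := fun s => (lo s, lo s ∪ range fun b => φ (Nat.pair 0 b))
  have hc : ∀ s, IsPair (c s) := by
    refine fun s => ⟨.of_subset subset_union_left, (hcol 0).mono ?_⟩
    rintro _ ⟨b, rfl⟩
    refine ⟨Or.inr ⟨b, rfl⟩, ?_⟩
    rintro (h | ⟨a, -, b', h⟩)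
    · exact (hφq _).2 h
    · have := (Nat.pair_eq_pair.1 (hφ h)).1
      omega
  have hcq : ∀ s, PairLE (c s) q := by
    refine fun s => ⟨.of_subset (subset_union_left.trans subset_rfl), hq.1.subset ?_⟩
    rintro x ⟨(h | ⟨a, -, b', rfl⟩) | ⟨b, rfl⟩, hx⟩
    · exact ⟨h, hx⟩
    · exact absurd (hφq _).1 hx
    · exact absurd (hφq _).1 hx
  by_contra! hcon
  choose j p hjp hdis using fun s => hcon (c s) (hc s) (hcq s)
  refine hJ.not_ge (Cardinal.mk_le_of_injective (f := j) ?_)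
  have key : ∀ s t, j s = j t → s ⊆ t := by
    intro s t hst a has
    by_contra hat
    have hp : p s = p t := Option.some.inj ((hjp s).symm.trans (hst ▸ hjp t))
    obtain ⟨X, hX, hX'⟩ := not_disjoint_iff.1 (hdis s)
    obtain ⟨Y, hY, hY'⟩ := not_disjoint_iff.1 (hdis t)
    have hmem : ∀ {Z u}, Z ∈ pairSeg (c u) → Z ∈ pairSeg (p s) → Z ∈ pairSeg (pairMeet (p s) q) :=
      fun h h' => (pairSeg_inter (p s) q).subset ⟨h', pairSeg_mono (hcq _) h⟩
    have hXY := diff_finite_of_mem_pairSeg (hf _ _ (hjp s)) (hmem hX hX') (hmem hY (hp ▸ hY'))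
    refine hcol (a + 1) (((hXY.union hX.2.1).union hY.2.2).subset ?_)
    rintro _ ⟨b, rfl⟩
    have h1 : φ (Nat.pair (a + 1) b) ∈ (c s).1 := Or.inr ⟨a, has, b, rfl⟩
    have h2 : φ (Nat.pair (a + 1) b) ∉ (c t).2 := by
      rintro ((h | ⟨a', ha', b', h⟩) | ⟨b', h⟩)
      · exact (hφq _).2 h
      · have := (Nat.pair_eq_pair.1 (hφ h)).1
        obtain rfl : a' = a := by omega
        exact hat ha'
      · have := (Nat.pair_eq_pair.1 (hφ h)).1
        omega
    simp only [mem_union, mem_sdiff]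
    tauto
  exact fun s t hst => (key s t hst).antisymm (key t s hst.symm)

theorem PairDense.exists_antichain {𝒟 : Set (Set ℕ × Set ℕ)} (h𝒟 : PairDense 𝒟) :
    ∃ R, IsAntichainIn 𝒟 R := by
  classical
  let I := (Cardinal.mk (Set ℕ)).ord.ToType
  have hI : Cardinal.mk I = Cardinal.mk (Set ℕ × Set ℕ) := by
    simp only [I, Cardinal.mk_ord_toType, Cardinal.mk_prod, Cardinal.lift_id]
    rw [Cardinal.mul_eq_self (Cardinal.aleph0_le_mk _)]
  obtain ⟨e⟩ := Cardinal.eq.1 hI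
  let good : (i : I) → (∀ j, j < i → Option (Set ℕ × Set ℕ)) → Set ℕ × Set ℕ → Prop :=
    fun i g r => r ∈ 𝒟 ∧ IsPair r ∧ PairLE r (e i) ∧
      ∀ j hj, ∀ s, g j hj = some s → Disjoint (pairSeg r) (pairSeg s)
  obtain ⟨f, hf⟩ := exists_wellFounded_rec
    (fun i g (b : Option (Set ℕ × Set ℕ)) =>
      (∀ r, b = some r → good i g r) ∧ (b = none → ¬ ∃ r, good i g r)) (by
      intro i g
      by_cases h : ∃ r, good i g r
      · obtain ⟨r, hr⟩ := h
        exact ⟨some r, by rintro _ ⟨⟩; exact hr, by simp⟩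
      · exact ⟨none, by simp, fun _ => h⟩)
  refine ⟨{r | ∃ i, f i = some r}, ?_, ?_, ?_, ?_⟩
  · rintro r ⟨i, hi⟩
    exact ((hf i).1 r hi).1
  · rintro r ⟨i, hi⟩
    exact ((hf i).1 r hi).2.1
  · rintro r ⟨i, hi⟩ s ⟨j, hj⟩ hrs
    rcases lt_trichotomy i j with hij | rfl | hij
    · exact (((hf j).1 s hj).2.2.2 i hij r hi).symm
    · exact absurd (Option.some.inj (hi.symm.trans hj)) hrs
    · exact ((hf i).1 r hi).2.2.2 j hij s hj
  · intro q hq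
    by_contra! hcon
    obtain ⟨i, rfl⟩ := e.surjective q
    have hnone : f i = none := by
      by_contra hne
      obtain ⟨r, hr⟩ := Option.ne_none_iff_exists'.1 hne
      obtain ⟨-, h1, h2, -⟩ := (hf i).1 r hr
      exact hcon r ⟨i, hr⟩ (h1.mono ((PairLE.refl r).pairMeet h2))
    obtain ⟨q', hq', hle, hdis⟩ := exists_pairLE_disjoint hq (fun j : Iio i => f j)
      (fun j s hs => hcon s ⟨j, hs⟩) (by simpa [I] using Cardinal.mk_Iio_lt i)
    obtain ⟨r, hr, hr', hrle⟩ := h𝒟 q' hq'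
    exact (hf i).2 hnone ⟨r, hr, hr', hrle.trans hle, fun j hj s hs =>
      (hdis ⟨j, hj⟩ s hs).mono_left (pairSeg_mono hrle)⟩

theorem IsAntichainIn.isVPartition {𝒟 R : Set (Set ℕ × Set ℕ)} (h : IsAntichainIn 𝒟 R) :
    IsVPartition (pairSeg '' R) := by
  obtain ⟨-, hpair, hdis, hpre⟩ := h
  refine ⟨?_, ?_, ?_⟩
  · rintro _ ⟨p, hp, rfl⟩
    exact (hpair p hp).isStarSeg
  · rintro _ ⟨p, hp, rfl⟩ _ ⟨q, hq, rfl⟩ hne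
    have := hdis p hp q hq (fun h => hne (h ▸ rfl))
    simp [StarDisjoint, this.inter_eq]
  · intro P hP _
    obtain ⟨q, hq, rfl⟩ := hP.exists_pair
    obtain ⟨p, hp, hpq⟩ := hpre q hq
    refine ⟨_, ⟨p, hp, rfl⟩, ?_⟩
    rw [StarDisjoint, inter_comm, ← StarDisjoint, starDisjoint_pairSeg]
    exact not_not.2 hpq

/-- If no v-matrix of size at most `#ι` is shattering, then some *-segment is below a member of
each of given `ι`-many dense sets. -/
theorem exists_pairLE_of_not_shattering {ι : Type}
    (hι : ∀ H : Set (Set (Set (Set ℕ))), Cardinal.mk H ≤ Cardinal.mk ι → ¬ Shattering H)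
    (𝒟 : ι → Set (Set ℕ × Set ℕ)) (h𝒟 : ∀ i, PairDense (𝒟 i)) :
    ∃ q, IsPair q ∧ ∀ i, ∃ p ∈ 𝒟 i, PairLE q p := by
  choose R hR using fun i => (h𝒟 i).exists_antichain
  have hns := hι (range fun i => pairSeg '' R i) Cardinal.mk_range_le
  simp only [Shattering, not_and, not_forall] at hns
  obtain ⟨A, B, hAB, hno⟩ := hns (by rintro _ ⟨i, rfl⟩; exact (hR i).isVPartition)
  refine ⟨(A, B), hAB.isPair, fun i => ?_⟩
  have huniq : ∀ r ∈ R i, ∀ s ∈ R i, IsPair (pairMeet r (A, B)) → IsPair (pairMeet s (A, B)) →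
      r = s := by
    intro r hr s hs hr' hs'
    by_contra hne
    have hd := (hR i).2.2.1 r hr s hs hne
    have hr1 : (pairSeg r ∩ StarSeg A B).Nonempty := by
      have := hr'.nonempty
      rwa [← pairSeg_inter] at this
    refine hno ⟨_, ⟨i, rfl⟩, _, ⟨r, hr, rfl⟩, _, ⟨s, hs, rfl⟩, ?_, ?_, ?_, ?_⟩
    · intro h
      obtain ⟨X, hX⟩ := hr1
      exact disjoint_left.1 hd hX.1 (h ▸ hX.1)
    · change IsStarSeg (pairSeg r ∩ pairSeg (A, B))
      exact pairSeg_inter r (A, B) ▸ hr'.isStarSeg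
    · change IsStarSeg (pairSeg s ∩ pairSeg (A, B))
      exact pairSeg_inter s (A, B) ▸ hs'.isStarSeg
    · intro h
      obtain ⟨X, hX⟩ := hr1
      exact disjoint_left.1 hd hX.1 (h.subset hX).1
  obtain ⟨r, hr, hrAB⟩ := (hR i).2.2.2 (A, B) hAB.isPair
  have hsub : ∀ q, IsPair q → PairLE q (A, B) → IsPair (pairMeet r q) := by
    intro q hq hle
    obtain ⟨s, hs, hsq⟩ := (hR i).2.2.2 q hq
    have := huniq r hr s hs hrAB
      (hsq.mono ((pairMeet_le_left s q).pairMeet ((pairMeet_le_right s q).trans hle)))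
    exact this ▸ hsq
  have h1 : AlmostSub r.1 B :=
    AlmostSub.trans (.of_subset subset_union_left) (hrAB.1.trans (.of_subset inter_subset_right))
  have h2 : AlmostSub A r.2 :=
    AlmostSub.trans (.of_subset subset_union_right) (hrAB.1.trans (.of_subset inter_subset_left))
  refine ⟨r, (hR i).1 hr, ?_, ?_⟩
  · by_contra hinf
    obtain ⟨x, hx, hxi, hxi'⟩ := exists_infinite_split (E := r.1 \ A) hinf
    have hq : IsPair (A, B \ x) := by
      refine ⟨hAB.isPair.1.subset fun n hn => ?_, fun hf => hxi' ((hf.union h1).subset fun n => ?_)⟩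
      · have := @hx n
        simp only [mem_sdiff] at *; tauto
      · simp only [mem_union, mem_sdiff]; tauto
    have := (hsub _ hq ⟨.of_subset subset_rfl, .of_subset sdiff_subset⟩).1
    refine hxi (this.subset fun n hn => ?_)
    have := @hx n
    simp only [pairMeet, mem_inter_iff, mem_union, mem_sdiff] at *; tauto
  · by_contra hinf
    have hinf' : ((B \ r.2) \ A).Infinite := fun hf => hinf ((hf.union h2).subset fun n => by
      simp only [mem_union, mem_sdiff]; tauto)
    obtain ⟨x, hx, hxi, hxi'⟩ := exists_infinite_split hinf'
    have hq : IsPair (A ∪ x, B) := by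
      refine ⟨hAB.isPair.1.subset fun n hn => ?_, hxi'.mono fun n hn => ?_⟩
      · have := @hx n
        simp only [mem_union, mem_sdiff] at *; tauto
      · simp only [mem_union, mem_sdiff] at *; tauto
    have := (hsub _ hq ⟨.of_subset subset_union_left, .of_subset subset_rfl⟩).1
    refine hxi (this.subset fun n hn => ?_)
    have := @hx n
    simp only [pairMeet, mem_inter_iff, mem_union, mem_sdiff] at *; tauto

/-- A version of `exists_pairLE_of_not_shattering` below an arbitrary *-segment. -/
theorem exists_pairLE_of_not_shattering_below {ι : Type}
    (hι : ∀ H : Set (Set (Set (Set ℕ))), Cardinal.mk H ≤ Cardinal.mk ι → ¬ Shattering H)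
    (𝒟 : ι → Set (Set ℕ × Set ℕ)) (h𝒟 : ∀ i, PairDense (𝒟 i)) {p : Set ℕ × Set ℕ} (hp : IsPair p) :
    ∃ q, IsPair q ∧ PairLE q p ∧ ∀ i, ∃ r ∈ 𝒟 i, PairLE q r := by
  let φ : ℕ → ℕ := fun n => hp.2.natEmbedding _ n
  have hφ : Function.Injective φ := Subtype.val_injective.comp (hp.2.natEmbedding _).injective
  have hφp : ∀ n, φ n ∈ p.2 \ p.1 := fun n => (hp.2.natEmbedding _ n).2
  let τ : Set ℕ → Set ℕ := fun C => p.1 ∪ φ '' C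
  have hmem : ∀ C n, φ n ∈ τ C ↔ n ∈ C := fun C n => by
    have := (hφp n).2
    simp [τ, hφ.eq_iff, this]
  have hτ : ∀ {C D}, AlmostSub C D → AlmostSub (τ C) (τ D) := by
    refine fun {C D} h => (h.image φ).subset ?_
    rintro _ ⟨hx | ⟨n, hn, rfl⟩, hx'⟩
    · exact absurd (Or.inl hx) hx'
    · exact ⟨n, ⟨hn, fun h => hx' ((hmem _ _).2 h)⟩, rfl⟩
  let σ : Set ℕ × Set ℕ → Set ℕ × Set ℕ := fun q => (τ q.1, τ q.2)
  have hσp : ∀ q, PairLE (σ q) p := by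
    refine fun q => ⟨.of_subset subset_union_left, hp.1.subset ?_⟩
    rintro _ ⟨hx | ⟨n, -, rfl⟩, hx'⟩
    · exact ⟨hx, hx'⟩
    · exact absurd (hφp n).1 hx'
  have hσ : ∀ q, IsPair q → IsPair (σ q) := by
    refine fun q hq => ⟨hτ hq.1, (hq.2.image hφ.injOn).mono ?_⟩
    rintro _ ⟨n, hn, rfl⟩
    exact ⟨(hmem _ _).2 hn.1, fun h => hn.2 ((hmem _ _).1 h)⟩
  obtain ⟨q, hq, hqi⟩ := exists_pairLE_of_not_shattering hι
    (fun i => {q | ∃ r ∈ 𝒟 i, PairLE (σ q) r}) (fun i q hq => by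
      obtain ⟨r, hr, hrp, hle⟩ := h𝒟 i (σ q) (hσ q hq)
      have hpre : ∀ {E : Set ℕ}, E.Finite → (φ ⁻¹' E).Finite := fun h => h.preimage hφ.injOn
      refine ⟨(φ ⁻¹' r.1, φ ⁻¹' r.2), ⟨r, hr, ?_, ?_⟩, ⟨hpre hrp.1, fun hf => ?_⟩, ?_, ?_⟩
      · refine (hrp.1.union hle.2).subset ?_
        rintro x ⟨hx, hx'⟩
        by_contra hn
        have h1 : x ∈ τ q.2 := by
          by_contra h
          by_cases h2 : x ∈ r.2
          · exact hn (Or.inr ⟨h2, h⟩)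
          · exact hn (Or.inl ⟨hx, h2⟩)
        rcases h1 with h1 | ⟨n, -, rfl⟩
        · exact hx' (Or.inl h1)
        · exact hx' ((hmem _ _).2 hx)
      · refine (hle.1.union hrp.1).subset ?_
        rintro x ⟨hx | ⟨n, hn, rfl⟩, hx'⟩
        · by_cases hxr : x ∈ r.1
          · exact Or.inr ⟨hxr, hx'⟩
          · exact Or.inl ⟨Or.inl hx, hxr⟩
        · exact absurd hn hx'
      · refine hrp.2 (((hle.2.union hle.1).union (hf.image φ)).subset ?_)
        rintro x ⟨hx, hx'⟩
        by_cases h2 : x ∈ τ q.2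
        · rcases h2 with h2 | ⟨n, -, rfl⟩
          · exact Or.inl (Or.inr ⟨Or.inl h2, hx'⟩)
          · exact Or.inr ⟨n, ⟨hx, hx'⟩, rfl⟩
        · exact Or.inl (Or.inl ⟨hx, h2⟩)
      · exact (hpre hle.1).subset fun n hn => ⟨(hmem _ _).2 hn.1, hn.2⟩
      · exact (hpre hle.2).subset fun n hn => ⟨hn.1, fun h => hn.2 ((hmem _ _).1 h)⟩)
  refine ⟨σ q, hσ q hq, hσp q, fun i => ?_⟩
  obtain ⟨q', ⟨r, hr, hle⟩, hqq'⟩ := hqi i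
  exact ⟨r, hr, PairLE.trans ⟨hτ hqq'.1, hτ hqq'.2⟩ hle⟩

/-- A shattering v-matrix exists. -/
theorem exists_shattering : ∃ H, Shattering H := by
  by_contra! hno
  obtain ⟨q, hq, hqi⟩ := exists_pairLE_of_not_shattering (ι := {𝒟 // PairDense 𝒟})
    (fun H _ => hno H) (fun 𝒟 => 𝒟.1) (fun 𝒟 => 𝒟.2)
  obtain ⟨p, hp, hqp⟩ := hqi ⟨{p | ¬ PairLE q p}, fun p hp => by
    obtain ⟨x, hx, hxi, hxi'⟩ := exists_infinite_split hp.2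
    by_cases h : PairLE q (p.1 ∪ x, p.2)
    · refine ⟨(p.1, p.2 \ x), fun h' => hxi ?_, ⟨hp.1.subset fun n hn => ?_, hxi'.mono ?_⟩,
        .of_subset subset_rfl, .of_subset sdiff_subset⟩
      · refine ((h.1.union hq.1).union h'.2).subset fun n => ?_
        simp only [mem_union, mem_sdiff]; tauto
      · have := @hx n
        simp only [mem_sdiff] at *; tauto
      · intro n
        simp only [mem_sdiff]; tauto
    · refine ⟨(p.1 ∪ x, p.2), h, ⟨hp.1.subset fun n hn => ?_, hxi'.mono ?_⟩,
        .of_subset subset_union_left, .of_subset subset_rfl⟩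
      · have := @hx n
        simp only [mem_union, mem_sdiff] at *; tauto
      · intro n
        simp only [mem_union, mem_sdiff]; tauto⟩
  exact hp hqp

theorem IsSeg.subset_of_seg_subset {A B C D : Set ℕ} (h : IsSeg C D) (hs : Seg C D ⊆ Seg A B) :
    A ⊆ C ∧ D ⊆ B := by
  have hD : D.Infinite := h.2.mono sdiff_subset
  refine ⟨fun a ha => ?_, (hs ⟨hD, h.1, subset_rfl⟩).2.2⟩
  by_contra hac
  have hX : D \ {a} ∈ Seg C D := ⟨hD.sdiff (finite_singleton a),
    fun x hx => ⟨h.1 hx, fun hxa => hac (hxa ▸ hx)⟩, sdiff_subset⟩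
  exact ((hs hX).2.1 ha).2 rfl

theorem IsVZero.exists_seg_forall_finset {S : Set (Set ℕ)} (hS : IsVZero S) (m : ℕ)
    (T : Finset (Finset ℕ)) {A B : Set ℕ} (hAB : IsSeg A B) :
    ∃ C D, IsSeg C D ∧ A ⊆ C ∧ D ⊆ B ∧ (∀ n < m, n ∈ C → n ∈ A) ∧ (∀ n < m, n ∈ B → n ∈ D) ∧
      ∀ s ∈ T, ∀ X : Set ℕ, X.Infinite → (∀ n < m, n ∈ X ↔ n ∈ s) → (∀ n ≥ m, n ∈ C → n ∈ X) →
        (∀ n ≥ m, n ∈ X → n ∈ D) → X ∉ S := by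
  classical
  induction T using Finset.induction_on with
  | empty => exact ⟨A, B, hAB, subset_rfl, subset_rfl, by simp, by simp, by simp⟩
  | insert s T _ ih =>
    obtain ⟨C, D, hCD, hAC, hDB, hC, hD, hT⟩ := ih
    have hfin : (Iio m).Finite := finite_Iio m
    obtain ⟨E, F, hEF, hsub, hemp⟩ := hS ({n | n ∈ s ∧ n < m} ∪ (C \ Iio m))
      ({n | n ∈ s ∧ n < m} ∪ (D \ Iio m))
      ⟨union_subset_union_right _ (sdiff_subset_sdiff_left hCD.1),
        (hCD.2.sdiff hfin).mono fun n hn => by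
          simp only [mem_union, mem_sdiff, mem_Iio, mem_ofPred_eq] at *; tauto⟩
    obtain ⟨hE, hF⟩ := hEF.subset_of_seg_subset hsub
    have hE' : ∀ n, (n ∈ s ∧ n < m) ∨ (n ∈ C ∧ ¬ n < m) → n ∈ E := hE
    have hF' : ∀ n, n ∈ F → (n ∈ s ∧ n < m) ∨ (n ∈ D ∧ ¬ n < m) := hF
    have hEF' : ∀ n, n ∈ E → n ∈ F := hEF.1
    have hCD' : ∀ n, n ∈ C → n ∈ D := hCD.1
    refine ⟨{n | (n ∈ C ∧ n < m) ∨ (n ∈ E ∧ ¬ n < m)}, {n | (n ∈ D ∧ n < m) ∨ (n ∈ F ∧ ¬ n < m)},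
      ⟨?_, ?_⟩, ?_, ?_, ?_, ?_, ?_⟩
    · rintro n (hn | hn)
      · exact Or.inl ⟨hCD' n hn.1, hn.2⟩
      · exact Or.inr ⟨hEF' n hn.1, hn.2⟩
    · refine (hEF.2.sdiff hfin).mono ?_
      rintro n ⟨⟨h1, h2⟩, h3⟩
      refine ⟨Or.inr ⟨h1, h3⟩, ?_⟩
      rintro (h | h)
      · exact h3 h.2
      · exact h2 h.1
    · intro n hn
      by_cases hnm : n < m
      · exact Or.inl ⟨hAC hn, hnm⟩
      · exact Or.inr ⟨hE' n (Or.inr ⟨hAC hn, hnm⟩), hnm⟩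
    · rintro n (hn | hn)
      · exact hDB hn.1
      · rcases hF' n hn.1 with h | h
        · exact absurd h.2 hn.2
        · exact hDB h.1
    · rintro n hnm (hn | hn)
      · exact hC n hnm hn.1
      · exact absurd hnm hn.2
    · exact fun n hnm hn => Or.inl ⟨hD n hnm hn, hnm⟩
    · intro t ht X hX h1 h2 h3
      rcases Finset.mem_insert.1 ht with rfl | ht
      · intro hXS
        have : X ∈ Seg E F := by
          refine ⟨hX, fun n hn => ?_, fun n hn => ?_⟩
          · rcases lt_or_ge n m with hnm | hnm
            · rcases hF' n (hEF' n hn) with h | h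
              · exact (h1 n hnm).2 h.1
              · exact absurd hnm h.2
            · exact h2 n hnm (Or.inr ⟨hn, hnm.not_gt⟩)
          · rcases lt_or_ge n m with hnm | hnm
            · exact hEF' n (hE' n (Or.inl ⟨(h1 n hnm).1 hn, hnm⟩))
            · rcases h3 n hnm hn with h | h
              · exact absurd h.2 hnm.not_gt
              · exact h.1
        exact (hemp ▸ (⟨this, hXS⟩ : X ∈ Seg E F ∩ S) : X ∈ (∅ : Set (Set ℕ)))
      · refine hT t ht X hX h1 (fun n hnm hn => h2 n hnm ?_) (fun n hnm hn => ?_)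
        · exact Or.inr ⟨hE' n (Or.inr ⟨hn, hnm.not_gt⟩), hnm.not_gt⟩
        · rcases h3 n hnm hn with h | h
          · exact h.1
          · rcases hF' n h.1 with h' | h'
            · exact absurd h'.2 h.2
            · exact h'.1

theorem IsVZero.exists_seg_agreeing_below {S : Set (Set ℕ)} (hS : IsVZero S) (m : ℕ)
    {A B : Set ℕ} (hAB : IsSeg A B) :
    ∃ C D, IsSeg C D ∧ A ⊆ C ∧ D ⊆ B ∧ (∀ n < m, n ∈ C → n ∈ A) ∧ (∀ n < m, n ∈ B → n ∈ D) ∧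
      ∀ X : Set ℕ, X.Infinite → (∀ n ≥ m, n ∈ C → n ∈ X) → (∀ n ≥ m, n ∈ X → n ∈ D) → X ∉ S := by
  classical
  obtain ⟨C, D, h, hAC, hDB, h1, h2, h3⟩ :=
    hS.exists_seg_forall_finset m (Finset.range m).powerset hAB
  refine ⟨C, D, h, hAC, hDB, h1, h2, fun X hX h4 h5 =>
    h3 ((Finset.range m).filter (· ∈ X)) (by simp) X hX (fun n hn => ?_) h4 h5⟩
  simp [hn]

/-- The fusion argument: below each *-segment there is one disjoint from a given v⁰-set. -/
theorem IsVZero.pairDense {S : Set (Set ℕ)} (hS : IsVZero S) :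
    PairDense {p | Disjoint (pairSeg p) S} := by
  intro q hq
  let State := {t : (Set ℕ × Set ℕ) × ℕ // IsSeg t.1.1 t.1.2}
  have hstep : ∀ t : State, ∃ u : State, t.1.1.1 ⊆ u.1.1.1 ∧ u.1.1.2 ⊆ t.1.1.2 ∧
      (∀ n < t.1.2, n ∈ u.1.1.1 → n ∈ t.1.1.1) ∧ (∀ n < t.1.2, n ∈ t.1.1.2 → n ∈ u.1.1.2) ∧
      (∀ X : Set ℕ, X.Infinite → (∀ n ≥ t.1.2, n ∈ u.1.1.1 → n ∈ X) →
        (∀ n ≥ t.1.2, n ∈ X → n ∈ u.1.1.2) → X ∉ S) ∧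
      ∃ k ≥ t.1.2, k < u.1.2 ∧ k ∈ u.1.1.2 ∧ k ∉ u.1.1.1 := by
    intro t
    obtain ⟨C, D, h, hAC, hDB, h1, h2, h3⟩ := hS.exists_seg_agreeing_below t.1.2 t.2
    obtain ⟨k, hk, hk'⟩ := h.2.exists_gt t.1.2
    exact ⟨⟨((C, D), k + 1), h⟩, hAC, hDB, h1, h2, h3, k, hk'.le, k.lt_succ_self, hk⟩
  choose next hA hB hA' hB' hX hk using hstep
  let t₀ : State := ⟨((q.1 ∩ q.2, q.2), 0), inter_subset_right, by simpa using hq.2⟩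
  let t : ℕ → State := fun n => next^[n] t₀
  have ht : ∀ n, t (n + 1) = next (t n) := fun n => Function.iterate_succ_apply' next n t₀
  let A : ℕ → Set ℕ := fun n => (t n).1.1.1
  let B : ℕ → Set ℕ := fun n => (t n).1.1.2
  let m : ℕ → ℕ := fun n => (t n).1.2
  have hAmono : Monotone A := monotone_nat_of_le_succ fun n => by
    simp only [A, ht]; exact hA _
  have hBanti : Antitone B := antitone_nat_of_succ_le fun n => by
    simp only [B, ht]; exact hB _
  have hmlt : ∀ n, m n < m (n + 1) := fun n => by
    obtain ⟨k, h1, h2, -⟩ := hk (t n)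
    simp only [m, ht]
    exact h1.trans_lt h2
  have hm : StrictMono m := strictMono_nat_of_lt_succ hmlt
  have hAB : ∀ n, A n ⊆ B n := fun n => (t n).2.1
  have hAle : ∀ n l, n ≤ l → ∀ x < m n, x ∈ A l → x ∈ A n := by
    intro n l hnl x hx
    induction l, hnl using Nat.le_induction with
    | base => exact id
    | succ l hnl ih =>
      intro h
      refine ih (hA' (t l) x (hx.trans_le (hm.monotone hnl)) ?_)
      rw [← ht]; exact h
  have hBle : ∀ n l, n ≤ l → ∀ x < m n, x ∈ B n → x ∈ B l := by
    intro n l hnl x hx h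
    induction l, hnl using Nat.le_induction with
    | base => exact h
    | succ l hnl ih =>
      have := hB' (t l) x (hx.trans_le (hm.monotone hnl)) ih
      rw [← ht] at this; exact this
  have hsub : (⋃ n, A n) ⊆ ⋂ n, B n := by
    refine iUnion_subset fun n => subset_iInter fun l => ?_
    exact (hAmono (le_max_left n l)).trans ((hAB _).trans (hBanti (le_max_right n l)))
  refine ⟨(⋃ n, A n, ⋂ n, B n), ?_, ⟨.of_subset hsub, ?_⟩, ?_, .of_subset (iInter_subset _ 0)⟩
  · refine disjoint_left.2 fun X hXs => ?_
    obtain ⟨N, hN⟩ := (hXs.2.1.union hXs.2.2).bddAbove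
    have hlarge : ∀ n ≥ m (N + 1), n ∉ ((⋃ n, A n) \ X) ∪ (X \ ⋂ n, B n) := by
      intro n hn hmem
      have h1 := hN hmem
      have h2 := hm.le_apply (x := N + 1)
      omega
    refine hX (t (N + 1)) X hXs.1 (fun n hn hnA => ?_) (fun n hn hnX => ?_)
    · by_contra hnX
      refine hlarge n hn (Or.inl ⟨mem_iUnion.2 ⟨N + 2, ?_⟩, hnX⟩)
      simp only [A, ht (N + 1)]; exact hnA
    · by_contra hnB
      refine hlarge n hn (Or.inr ⟨hnX, fun h => hnB ?_⟩)
      have := mem_iInter.1 h (N + 2)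
      simp only [B, ht (N + 1)] at this; exact this
  · refine infinite_of_forall_exists_gt fun n => ?_
    obtain ⟨k, h1, h2, h3, h4⟩ := hk (t (n + 1))
    rw [← ht] at h2 h3 h4
    refine ⟨k, ⟨mem_iInter.2 fun l => ?_, fun h => ?_⟩, ?_⟩
    · rcases le_total (n + 1 + 1) l with hl | hl
      · exact hBle _ _ hl k h2 h3
      · exact hBanti hl h3
    · obtain ⟨l, hl'⟩ := mem_iUnion.1 h
      rcases le_total (n + 1 + 1) l with hl | hl
      · exact h4 (hAle _ _ hl k h2 hl')
      · exact h4 (hAmono hl hl')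
    · exact (Nat.lt_succ_self n).trans_le ((hm.le_apply (x := n + 1)).trans h1)
  · refine AlmostSub.trans ?_ (.of_subset (subset_iUnion A 0))
    refine hq.1.subset fun x hx => ⟨hx.1, fun h => hx.2 ⟨hx.1, h⟩⟩

theorem isVZero_sUnion_of_not_shattering {F : Set (Set (Set ℕ))}
    (hF : ∀ H : Set (Set (Set (Set ℕ))), Cardinal.mk H ≤ Cardinal.mk F → ¬ Shattering H)
    (hS : ∀ S ∈ F, IsVZero S) : IsVZero (⋃₀ F) := by
  intro A B hAB
  obtain ⟨q, hq, hle, hqi⟩ := exists_pairLE_of_not_shattering_below hF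
    (fun S => {p | Disjoint (pairSeg p) S.1}) (fun S => (hS S.1 S.2).pairDense) hAB.isPair
  obtain ⟨C, D, hCD, h1, h2⟩ := hq.exists_seg hAB hle
  refine ⟨C, D, hCD, h1, ?_⟩
  rw [← disjoint_iff_inter_eq_empty, disjoint_sUnion_right]
  intro S hS'
  obtain ⟨p, hp, hqp⟩ := hqi ⟨S, hS'⟩
  exact Disjoint.mono_left (h2.trans (pairSeg_mono hqp)) hp

theorem IsVPartition.pairDense {P : Set (Set (Set ℕ))} (hP : IsVPartition P) :
    PairDense {p | ∃ Q ∈ P, pairSeg p ⊆ Q} := by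
  intro q hq
  by_cases hqP : pairSeg q ∈ P
  · exact ⟨q, ⟨_, hqP, subset_rfl⟩, hq, .refl q⟩
  · obtain ⟨X, hX, hqX⟩ := hP.2.2 _ hq.isStarSeg hqP
    obtain ⟨p, -, rfl⟩ := (hP.1 X hX).exists_pair
    rw [starDisjoint_pairSeg, not_not] at hqX
    exact ⟨_, ⟨_, hX, pairSeg_mono (pairMeet_le_right q p)⟩, hqX, pairMeet_le_left q p⟩

/-- The infinite sets that avoid all *-segments of a predense family form a v⁰-set. -/
theorem IsAntichainIn.isVZero_compl {𝒟 R : Set (Set ℕ × Set ℕ)} (h : IsAntichainIn 𝒟 R) :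
    IsVZero {X | X.Infinite ∧ ∀ p ∈ R, X ∉ pairSeg p} := by
  intro A B hAB
  obtain ⟨p, hp, hpAB⟩ := h.2.2.2 _ hAB.isPair
  obtain ⟨C, D, hCD, h1, h2⟩ := hpAB.exists_seg hAB (pairMeet_le_right _ _)
  refine ⟨C, D, hCD, h1, eq_empty_of_forall_notMem fun X hX => ?_⟩
  exact hX.2.2 p hp (pairSeg_mono (pairMeet_le_left _ _) (h2 hX.1))

/-- A `⊆*`-decreasing sequence of fewer than `t` infinite sets has an infinite
pseudo-intersection. -/
theorem exists_pseudointersection {I : Type} [LinearOrder I] [WellFoundedLT I]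
    (hI : Cardinal.mk I < tNum) (E : I → Set ℕ) (hinf : ∀ i, (E i).Infinite)
    (hE : ∀ i j, j ≤ i → AlmostSub (E i) (E j)) :
    ∃ X : Set ℕ, X.Infinite ∧ ∀ i, AlmostSub X (E i) := by
  let J : Set I := {i | ∀ j < i, ¬ AlmostSub (E j) (E i)}
  have hJ : ∀ i, ∃ j ∈ J, AlmostSub (E j) (E i) := by
    intro i
    obtain ⟨j, hj, hmin⟩ := WellFounded.has_min (wellFounded_lt (α := I))
      {j | AlmostSub (E j) (E i)} ⟨i, .of_subset subset_rfl⟩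
    exact ⟨j, fun k hk hkj => hmin k (hkj.trans hj) hk, hj⟩
  have hlt : ∀ i ∈ J, ∀ j ∈ J, (j < i ↔ StrictAlmostSub (E i) (E j)) := by
    refine fun i hi j _ => ⟨fun h => ⟨hE i j h.le, hi j h⟩, fun h => ?_⟩
    by_contra hji
    exact h.2 (hE j i (not_lt.1 hji))
  have hinj : ∀ i ∈ J, ∀ j ∈ J, E i = E j → i = j := by
    intro i hi j hj hij
    rcases lt_trichotomy i j with h | h | h
    · exact absurd (AlmostSub.of_subset hij.subset) (hj i h)
    · exact h
    · exact absurd (AlmostSub.of_subset hij.symm.subset) (hi j h)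
  choose g hgJ hg using fun A : E '' J => A.2
  have hrel : ∀ A B : E '' J, StrictAlmostSub (B : Set ℕ) (A : Set ℕ) ↔ g A < g B := by
    intro A B
    rw [hlt _ (hgJ B) _ (hgJ A), hg, hg]
  have hgi : Function.Injective g := fun A B h => Subtype.ext (by rw [← hg A, ← hg B, h])
  have hwo : IsWellOrder (E '' J)
      (fun A B => StrictAlmostSub (B : Set ℕ) (A : Set ℕ)) := by
    have : (fun A B : E '' J => StrictAlmostSub (B : Set ℕ) (A : Set ℕ)) =
        fun A B => g A < g B := by
      funext A B
      exact propext (hrel A B)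
    rw [this]
    exact (RelEmbedding.preimage ⟨g, hgi⟩ (fun i j : I => i < j)).isWellOrder
  by_contra! hno
  have hcard : Cardinal.mk (E '' J) < tNum :=
    ((Cardinal.mk_image_le).trans (Cardinal.mk_set_le J)).trans_lt hI
  refine notMem_of_lt_csInf' hcard ⟨E '' J, ?_, hwo, ?_, rfl⟩
  · rintro _ ⟨i, -, rfl⟩
    exact hinf i
  · rintro ⟨X, hX, hXE⟩
    obtain ⟨i, hi⟩ := hno X hX
    obtain ⟨j, hj, hji⟩ := hJ i
    exact hi ((hXE _ ⟨j, hj, rfl⟩).trans hji)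

/-- If fewer than `t` decreasing *-segments have a common member, then they contain a common
*-segment. -/
theorem exists_pairLE_of_decreasing {I : Type} [LinearOrder I] [WellFoundedLT I]
    (hI : Cardinal.mk I < tNum) (p : I → Set ℕ × Set ℕ) (hp : ∀ i, IsPair (p i))
    (hle : ∀ i j, j ≤ i → PairLE (p i) (p j)) {X : Set ℕ} (hX : ∀ i, X ∈ pairSeg (p i)) :
    ∃ q, IsPair q ∧ ∀ i, PairLE q (p i) := by
  obtain ⟨E, hE, hEi⟩ := exists_pseudointersection hI (fun i => (p i).2 \ (p i).1)
    (fun i => (hp i).2) (fun i j hij => ((hle i j hij).1.union (hle i j hij).2).subset fun x => by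
      simp only [mem_union, mem_sdiff]; tauto)
  refine ⟨(X \ E, X ∪ E), ⟨.of_subset (sdiff_subset.trans subset_union_left), ?_⟩, fun i => ⟨?_, ?_⟩⟩
  · refine hE.mono fun x => ?_
    simp only [mem_union, mem_sdiff]; tauto
  · refine ((hX i).2.1.union (hEi i)).subset fun x => ?_
    simp only [mem_union, mem_sdiff]; tauto
  · refine ((hX i).2.2.union (hEi i)).subset fun x => ?_
    simp only [mem_union, mem_sdiff]; tauto

theorem not_shattering_of_card_lt {H : Set (Set (Set (Set ℕ)))} (h : Cardinal.mk H < kappaV) :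
    ¬ Shattering H :=
  fun hH => notMem_of_lt_csInf' h ⟨H, hH, rfl⟩

theorem exists_cover_of_kappaV_lt_tNum (h : kappaV < tNum) :
    ∃ F : Set (Set (Set ℕ)), (∀ S ∈ F, IsVZero S) ∧ ⋃₀ F = {X : Set ℕ | X.Infinite} ∧
      Cardinal.mk F ≤ kappaV := by
  obtain ⟨H, hH, hHk⟩ : kappaV ∈ {c : Cardinal | ∃ H, Shattering H ∧ Cardinal.mk ↥H = c} :=
    csInf_mem (exists_shattering.elim fun H hH => ⟨_, H, hH, rfl⟩)
  let I := kappaV.ord.ToType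
  have hI : Cardinal.mk I = kappaV := Cardinal.mk_ord_toType _
  obtain ⟨e⟩ := Cardinal.eq.1 (hI.trans hHk.symm)
  let 𝒟 : (i : I) → (∀ j, j < i → Set (Set ℕ × Set ℕ)) → Set (Set ℕ × Set ℕ) := fun i g =>
    {p | (∃ Q ∈ (e i).1, pairSeg p ⊆ Q) ∧ ∀ j hj, ∃ q ∈ g j hj, PairLE p q}
  obtain ⟨R, hR⟩ := exists_wellFounded_rec
    (fun i g (b : Set (Set ℕ × Set ℕ)) => PairDense (𝒟 i g) → IsAntichainIn (𝒟 i g) b)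
    (fun i g => by
      by_cases hd : PairDense (𝒟 i g)
      · exact hd.exists_antichain.imp fun _ h _ => h
      · exact ⟨∅, fun h => absurd h hd⟩)
  have hR' : ∀ i, IsAntichainIn (𝒟 i fun j _ => R j) (R i) := by
    intro i
    induction i using WellFoundedLT.induction with
    | ind i ih =>
    refine hR i fun q hq => ?_
    obtain ⟨p, ⟨Q, hQ, hpQ⟩, hp, hpq⟩ := (hH.1 _ (e i).2).pairDense q hq
    have hcard : Cardinal.mk (Iio i) < kappaV := by simpa [I] using Cardinal.mk_Iio_lt i
    obtain ⟨r, hr, hrp, hri⟩ := exists_pairLE_of_not_shattering_below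
      (fun H hH => not_shattering_of_card_lt (hH.trans_lt hcard))
      (fun j : Iio i => {p | ∃ q ∈ R j, PairLE p q}) (fun j q hq => by
        obtain ⟨s, hs, hsq⟩ := (ih j j.2).2.2.2 q hq
        exact ⟨_, ⟨s, hs, pairMeet_le_left s q⟩, hsq, pairMeet_le_right s q⟩) hp
    refine ⟨r, ⟨⟨Q, hQ, (pairSeg_mono hrp).trans hpQ⟩, fun j hj => ?_⟩, hr, hrp.trans hpq⟩
    obtain ⟨s, ⟨s', hs', hss'⟩, hrs⟩ := hri ⟨j, hj⟩
    exact ⟨s', hs', hrs.trans hss'⟩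
  refine ⟨range fun i => {X | X.Infinite ∧ ∀ p ∈ R i, X ∉ pairSeg p}, ?_, ?_,
    Cardinal.mk_range_le.trans hI.le⟩
  · rintro _ ⟨i, rfl⟩
    exact (hR' i).isVZero_compl
  · refine Subset.antisymm (sUnion_subset ?_) fun X hX => ?_
    · rintro _ ⟨i, rfl⟩ X hX
      exact hX.1
    · by_contra hcon
      have hcon' : ∀ i, ∃ p ∈ R i, X ∈ pairSeg p := by
        intro i
        by_contra! hi
        exact hcon ⟨_, ⟨i, rfl⟩, hX, hi⟩
      choose p hpR hXp using hcon'
      have hle : ∀ i j, j ≤ i → PairLE (p i) (p j) := by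
        intro i j hji
        rcases hji.eq_or_lt with rfl | hji
        · exact .refl _
        obtain ⟨q, hq, hpq⟩ := ((hR' i).1 (hpR i)).2 j hji
        have : q = p j := by
          by_contra hne
          exact disjoint_left.1 ((hR' j).2.2.1 q hq _ (hpR j) hne)
            (pairSeg_mono hpq (hXp i)) (hXp j)
        exact this ▸ hpq
      obtain ⟨q, hq, hqp⟩ := exists_pairLE_of_decreasing (hI.trans_lt h) p
        (fun i => (hR' i).2.1 _ (hpR i)) hle hXp
      have hqs := hq.isStarSeg
      obtain ⟨A, B, hAB, hqAB⟩ := hqs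
      obtain ⟨P, hP, Y, hY, Z, hZ, hYZ, hYs, hZs, -⟩ := hH.2 A B hAB
      obtain ⟨i, hi⟩ := e.surjective ⟨P, hP⟩
      obtain ⟨Q, hQ, hpQ⟩ := ((hR' i).1 (hpR i)).1
      rw [hi] at hQ
      have hABQ : StarSeg A B ⊆ Q := hqAB ▸ (pairSeg_mono (hqp i)).trans hpQ
      have huniq : ∀ W ∈ P, IsStarSeg (W ∩ StarSeg A B) → W = Q := by
        intro W hW hWs
        by_contra hne
        exact hWs.not_countable (((hH.1 P hP).2.1 W hW Q hQ hne).mono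
          (inter_subset_inter_right _ hABQ))
      exact hYZ ((huniq Y hY hYs).trans (huniq Z hZ hZs).symm)

/-- If `κ(v) < t` then `add(v⁰) = cov(v⁰)`. -/
theorem addV0_eq_covV0_of_kappaV_lt_tNum (h : kappaV < tNum) : addV0 = covV0 := by
  obtain ⟨F₀, hF₀, hcov, hcard⟩ := exists_cover_of_kappaV_lt_tNum h
  have hnot : ∀ F : Set (Set (Set ℕ)), ⋃₀ F = {X : Set ℕ | X.Infinite} → ¬ IsVZero (⋃₀ F) := by
    intro F hF hv
    obtain ⟨C, D, hCD, -, hemp⟩ := hv ∅ univ ⟨empty_subset _, by simpa using infinite_univ⟩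
    have hD : D.Infinite := hCD.2.mono sdiff_subset
    rw [hF] at hemp
    exact (hemp.subset ⟨⟨hD, hCD.1, subset_rfl⟩, hD⟩ : D ∈ (∅ : Set (Set ℕ)))
  apply le_antisymm
  · refine le_csInf ⟨_, F₀, hF₀, hcov, rfl⟩ ?_
    rintro _ ⟨F, hF, hFcov, rfl⟩
    exact csInf_le' ⟨F, hF, hnot F hFcov, rfl⟩
  · refine le_csInf ⟨_, F₀, hF₀, hnot F₀ hcov, rfl⟩ ?_
    rintro _ ⟨F, hF, hFnot, rfl⟩
    refine (csInf_le' ⟨F₀, hF₀, hcov, rfl⟩ : covV0 ≤ _).trans (hcard.trans ?_)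
    by_contra! hlt
    exact hFnot (isVZero_sUnion_of_not_shattering
      (fun H hH => not_shattering_of_card_lt (hH.trans_lt hlt)) hF)
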